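/- arXiv:0710.3036 — 2 statements merged into one kernel-verified Lean document; each statement's English description precedes it below -/
import Mathlib

section
/- Let D_n = (N, A) be the complete digraph on n ≥ 6 nodes and c = (c_1,…,c_m) a cardinality sequence with m ≥ 3, 2 ≤ c_1 < ⋯ < c_m ≤ n, and c_{p+2} = c_{p+1} + 2 = c_p + 4 for some p with 2 ≤ p ≤ m − 2. Let N = U ∪̇ Q ∪̇ {r} be a partition of N with 1 ∈ U and |U| = c_p + 1 = c_{p+1} − 1. Then the modified cardinality forcing inequality Σ_{v∈U} x(δ^out(v)) − Σ_{v∈Q} x(δ^out(v)) + x((Q : {r})) − x((U : {r})) ≤ c_p is valid for P* := {x ∈ P_C^c(D_n) : x(δ^out(1)) = 1} and defines a facet of P*. -/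
open Finset

/-- A simple directed cycle in a digraph on the node set `Fin N`, encoded by its arc set:
there is an injective map `f` from the cyclically ordered index set `Fin (k+2)` (so the
cycle has length at least `2`) to the nodes, whose consecutive pairs are exactly the arcs
of `C`. -/
def IsSimpleCycle {N : ℕ} (C : Finset (Fin N × Fin N)) : Prop :=
  ∃ (k : ℕ) (f : Fin (k + 2) → Fin N), Function.Injective f ∧
    C = Finset.image (fun i : Fin (k + 2) => (f i, f (i + 1))) Finset.univ

/-- Incidence vector of an arc set. -/
noncomputable def incVec {N : ℕ} (C : Finset (Fin N × Fin N)) : Fin N → Fin N → ℝ :=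
  fun i j => if (i, j) ∈ C then 1 else 0

/-- The cardinality constrained cycle polytope `P_C^c(D_N)` of the complete digraph on
`Fin N`: the convex hull of the incidence vectors of simple directed cycles whose
cardinality is `c p` for some `p`. -/
noncomputable def cyclePolytope (N : ℕ) {m : ℕ} (c : Fin m → ℕ) :
    Set (Fin N → Fin N → ℝ) :=
  convexHull ℝ {x | ∃ C : Finset (Fin N × Fin N), IsSimpleCycle C ∧
    (∃ p, C.card = c p) ∧ x = incVec C}

/-- `x(δ^out(i))` in the complete digraph on `Fin N`. -/
noncomputable def outSum {N : ℕ} (x : Fin N → Fin N → ℝ) (i : Fin N) : ℝ :=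
  ∑ j ∈ Finset.univ.erase i, x i j

/-- The dimension (of the affine hull) of a subset of a real vector space. -/
noncomputable def adim {V : Type*} [AddCommGroup V] [Module ℝ V] (P : Set V) : ℕ :=
  Module.finrank ℝ (vectorSpan ℝ P)

/-- The valid inequality `f x ≤ b` defines a facet of `P`: it is valid and its face has
dimension `(dim P) - 1`. -/
def IsFacetLE {V : Type*} [AddCommGroup V] [Module ℝ V] (P : Set V) (f : V → ℝ) (b : ℝ) :
    Prop :=
  (∀ x ∈ P, f x ≤ b) ∧ adim {x ∈ P | f x = b} + 1 = adim P

/-- The total weight of the arcs of the walk that starts in `x`, runs through the list and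
ends in `e`. -/
def pathWeight {α : Type*} (G : α → α → ℝ) : α → List α → α → ℝ
  | x, [], e => G x e
  | x, y :: l, e => G x y + pathWeight G y l e

section PathWeight

variable {α : Type*} (G H : α → α → ℝ)

lemma pathWeight_append (x : α) (s : List α) (y : α) (t : List α) (e : α) :
    pathWeight G x (s ++ y :: t) e = pathWeight G x s y + pathWeight G y t e := by
  induction s generalizing x with
  | nil => rfl
  | cons z s ih => simp [pathWeight, ih, add_assoc]

lemma pathWeight_ofFn (k : ℕ) (f : Fin (k + 1) → α) (e : α) :
    pathWeight G (f 0) (List.ofFn fun i : Fin k => f i.succ) e =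
      ∑ i : Fin k, G (f i.castSucc) (f i.succ) + G (f (Fin.last k)) e := by
  induction k with
  | zero => simp [pathWeight]
  | succ k ih =>
    have h := ih (fun i => f i.succ)
    rw [List.ofFn_succ, pathWeight, Fin.sum_univ_succ, h]
    simp [add_assoc]

variable {G H} in
lemma pathWeight_congr {x e : α} {t : List α} (ht : (x :: t).Nodup) (he : e ∉ t)
    (hxe : t = [] → x ≠ e)
    (hGH : ∀ i ∈ x :: t, ∀ j ∈ e :: t, i ≠ j → G i j = H i j) :
    pathWeight G x t e = pathWeight H x t e := by
  induction t generalizing x with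
  | nil => exact hGH x (by simp) e (by simp) (hxe rfl)
  | cons y t ih =>
    have hxy : x ≠ y := by
      rintro rfl
      simp at ht
    rw [pathWeight, pathWeight, hGH x (by simp) y (by simp) hxy]
    congr 1
    refine ih ht.of_cons (fun h => he (by simp [h])) ?_ fun i hi j hj => hGH i ?_ j ?_
    · rintro - rfl
      simp at he
    · exact List.mem_cons_of_mem _ hi
    · simp only [List.mem_cons] at hj ⊢
      tauto

lemma pathWeight_linear_comb (a b d : α → α → ℝ) (l s : ℝ) (x : α) (t : List α) (e : α) :
    pathWeight (fun i j => a i j - l * b i j - s * d i j) x t e =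
      pathWeight a x t e - l * pathWeight b x t e - s * pathWeight d x t e := by
  induction t generalizing x with
  | nil => rfl
  | cons y t ih =>
    simp only [pathWeight, ih]
    ring

lemma pathWeight_add_separable (a b : α → ℝ) (x : α) (t : List α) (e : α) :
    pathWeight (fun i j => a i + b j) x t e =
      a x + b e + (t.map fun i => a i + b i).sum := by
  induction t generalizing x with
  | nil => simp [pathWeight]
  | cons y t ih =>
    simp only [pathWeight, ih, List.map_cons, List.sum_cons]
    ring

variable {G} in
/-- If the weights split as `a i + b j`, every closed walk through the nodes of `S` has the
same weight. -/
lemma pathWeight_eq_sum [DecidableEq α] {S : Finset α} {a b : α → ℝ} {x : α} {t : List α}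
    (ht : (x :: t).Nodup) (hne : t ≠ []) (hS : (x :: t).toFinset = S)
    (hG : ∀ i ∈ S, ∀ j ∈ S, i ≠ j → G i j = a i + b j) :
    pathWeight G x t x = ∑ i ∈ S, (a i + b i) := by
  have hx : x ∉ t := (List.nodup_cons.1 ht).1
  rw [pathWeight_congr (H := fun i j => a i + b j) ht hx (fun h => absurd h hne)
    (fun i hi j hj => hG i (by rw [← hS]; simpa using hi) j (by rw [← hS]; simpa using hj)),
    pathWeight_add_separable, ← hS, List.sum_toFinset _ ht, List.map_cons, List.sum_cons]

variable {G} in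
lemma pathWeight_const {x e : α} {t : List α} {r : ℝ} (ht : (x :: t).Nodup) (he : e ∉ t)
    (hxe : t = [] → x ≠ e)
    (hG : ∀ i ∈ x :: t, ∀ j ∈ e :: t, i ≠ j → G i j = r) :
    pathWeight G x t e = (t.length + 1) * r := by
  rw [pathWeight_congr (H := fun _ _ => 0 + r) ht he hxe (by simpa using hG),
    pathWeight_add_separable]
  simp
  ring

end PathWeight

/-- If all Hamiltonian cycles on `S` have the same weight, then the cost of inserting `v`
between two other nodes of `S` does not depend on these nodes. -/
lemma exists_insertion_cost {α : Type*} [DecidableEq α] {G : α → α → ℝ} {S : Finset α} {v : α}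
    {γ : ℝ} (hv : v ∈ S) (hS : 5 ≤ S.card)
    (hG : ∀ t : List α, (v :: t).Nodup → (v :: t).toFinset = S → pathWeight G v t v = γ) :
    ∃ κ : ℝ, ∀ x ∈ S.erase v, ∀ y ∈ S.erase v, x ≠ y → G x y = G x v + G v y - κ := by
  set T := S.erase v with hT
  have hTcard : 4 ≤ T.card := by
    rw [hT, Finset.card_erase_of_mem hv]
    omega
  have hshift : ∀ x ∈ T, ∀ y ∈ T, ∀ z ∈ T, x ≠ y → y ≠ z → x ≠ z →
      G x v + G v y - G x y = G y v + G v z - G y z := by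
    intro x hx y hy z hz hxy hyz hxz
    have hx' := Finset.mem_erase.1 hx
    have hy' := Finset.mem_erase.1 hy
    have hz' := Finset.mem_erase.1 hz
    set R := (S \ {v, x, y, z}).toList with hR
    have hmem : ∀ u, u ∈ R ↔ u ∈ S ∧ u ≠ v ∧ u ≠ x ∧ u ≠ y ∧ u ≠ z := by
      intro u
      simp [hR]
    have hRn : R.Nodup := Finset.nodup_toList _
    have h1 := hG (y :: z :: (R ++ [x]))
      (by
        simp only [List.nodup_cons, List.mem_cons, List.mem_append, List.nodup_append, hmem]
        grind)
      (by
        ext u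
        simp only [List.mem_toFinset, List.mem_cons, List.mem_append, hmem]
        grind)
    have h2 := hG (z :: (R ++ [x, y]))
      (by
        simp only [List.nodup_cons, List.mem_cons, List.mem_append, List.nodup_append, hmem]
        grind)
      (by
        ext u
        simp only [List.mem_toFinset, List.mem_cons, List.mem_append, hmem]
        grind)
    simp only [pathWeight, pathWeight_append] at h1 h2
    linarith
  have hex : ∀ x y z : α, ∃ u ∈ T, u ≠ x ∧ u ≠ y ∧ u ≠ z := by
    intro x y z
    have : ¬ T ⊆ {x, y, z} := fun h => by
      have := Finset.card_le_card h
      have := Finset.card_le_three (a := x) (b := y) (c := z)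
      omega
    obtain ⟨u, hu, hu'⟩ := Finset.not_subset.1 this
    exact ⟨u, hu, by simpa using hu'⟩
  have hout : ∀ x ∈ T, ∀ y ∈ T, ∀ z ∈ T, x ≠ y → x ≠ z →
      G x v + G v y - G x y = G x v + G v z - G x z := by
    intro x hx y hy z hz hxy hxz
    obtain ⟨u, hu, hux, huy, huz⟩ := hex x y z
    rw [← hshift u hu x hx y hy hux hxy huy, ← hshift u hu x hx z hz hux hxz huz]
  have hin : ∀ x ∈ T, ∀ y ∈ T, ∀ z ∈ T, x ≠ z → y ≠ z →
      G x v + G v z - G x z = G y v + G v z - G y z := by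
    intro x hx y hy z hz hxz hyz
    obtain ⟨u, hu, hux, huy, huz⟩ := hex x y z
    rw [hshift x hx z hz u hu hxz huz.symm hux.symm, hshift y hy z hz u hu hyz huz.symm huy.symm]
  obtain ⟨x₀, hx₀⟩ : T.Nonempty := Finset.card_pos.1 (by omega)
  obtain ⟨y₀, hy₀, hxy₀, -, -⟩ := hex x₀ x₀ x₀
  refine ⟨G x₀ v + G v y₀ - G x₀ y₀, fun x hx y hy hxy => ?_⟩
  obtain ⟨u, hu, hux, hux₀, -⟩ := hex x x₀ x
  have h1 := hout x hx y hy u hu hxy hux.symm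
  have h2 := hin x hx x₀ hx₀ u hu hux.symm hux₀.symm
  have h3 := hout x₀ hx₀ u hu y₀ hy₀ hux₀.symm hxy₀.symm
  linarith

/-- `1` on `U`, `-1` on `Q` and `0` elsewhere (for disjoint `U` and `Q`). -/
noncomputable def nodeSign {α : Type*} [DecidableEq α] (U Q : Finset α) (i : α) : ℝ :=
  (if i ∈ U then 1 else 0) - (if i ∈ Q then 1 else 0)

/-- The arc coefficients of the modified cardinality forcing inequality. -/
noncomputable def forcingCoeff {α : Type*} [DecidableEq α] (U Q : Finset α) (w i j : α) : ℝ :=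
  (if j = i then 0 else nodeSign U Q i) - (if j = w then nodeSign U Q i else 0)

section Forcing

variable {α : Type*} [DecidableEq α] {U Q : Finset α} {w : α}

lemma nodeSign_of_mem_left (hUQ : Disjoint U Q) {i : α} (hi : i ∈ U) : nodeSign U Q i = 1 := by
  simp [nodeSign, hi, Finset.disjoint_left.1 hUQ hi]

lemma nodeSign_of_mem_right (hUQ : Disjoint U Q) {i : α} (hi : i ∈ Q) :
    nodeSign U Q i = -1 := by
  simp [nodeSign, hi, Finset.disjoint_right.1 hUQ hi]

lemma nodeSign_of_notMem {i : α} (hU : i ∉ U) (hQ : i ∉ Q) : nodeSign U Q i = 0 := by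
  simp [nodeSign, hU, hQ]

lemma forcingCoeff_of_ne {i j : α} (hij : i ≠ j) :
    forcingCoeff U Q w i j = if j = w then 0 else nodeSign U Q i := by
  unfold forcingCoeff
  rw [if_neg hij.symm]
  split_ifs <;> simp

/-- A functional that is constant on the tight cycles through `v` of the modified cardinality
forcing inequality is a combination of this inequality, node potentials and the out-degree
of `v`. -/
lemma exists_combination_of_const_on_tight {v : α} {s : ℕ} (hUQ : Disjoint U Q)
    (hwU : w ∉ U) (hwQ : w ∉ Q) (hcover : ∀ i, i ∈ U ∨ i ∈ Q ∨ i = w) (hv : v ∈ U)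
    (hU : U.card = s + 1) (hs : 3 ≤ s) (hQ : 2 ≤ Q.card) {g : α → α → ℝ} {γ : ℝ}
    (H : ∀ t : List α, (v :: t).Nodup →
      (t.length + 1 = s ∨ t.length + 1 = s + 2 ∨ t.length + 1 = s + 4) →
      pathWeight (forcingCoeff U Q w) v t v = s → pathWeight g v t v = γ) :
    ∃ (l σ : ℝ) (π : α → ℝ), ∀ i j, i ≠ j →
      g i j = l * forcingCoeff U Q w i j + (π i - π j) + (if i = v then σ else 0) := by
  have hneU : ∀ {y}, y ∉ U → y ≠ v := fun hy => (ne_of_mem_of_not_mem hv hy).symm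
  have hHam : ∀ y ∉ U, ∀ t : List α, (v :: t).Nodup → (v :: t).toFinset = insert y U →
      t ≠ [] ∧ pathWeight g v t v = γ := by
    intro y hy t ht hS
    have hlen : t.length + 1 = s + 2 := by
      have := List.toFinset_card_of_nodup ht
      rw [hS, Finset.card_insert_of_notMem hy, hU] at this
      simpa using this.symm
    have hne : t ≠ [] := by
      rintro rfl
      simp at hlen
    refine ⟨hne, H t ht (Or.inr (Or.inl hlen)) ?_⟩
    rw [pathWeight_eq_sum (a := nodeSign U Q) (b := fun j => if j = w then -1 else 0) ht hne hS,
      Finset.sum_insert hy, Finset.sum_congr rfl (g := fun _ => (1 : ℝ))]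
    · have hy' : nodeSign U Q y + (if y = w then -1 else 0) = -1 := by
        rcases hcover y with h | h | rfl
        · exact absurd h hy
        · rw [nodeSign_of_mem_right hUQ h, if_neg (ne_of_mem_of_not_mem h hwQ), add_zero]
        · rw [nodeSign_of_notMem hwU hwQ, if_pos rfl, zero_add]
      rw [hy', Finset.sum_const, hU]
      simp
    · intro i hi
      rw [nodeSign_of_mem_left hUQ hi, if_neg (ne_of_mem_of_not_mem hi hwU), add_zero]
    · intro i hi j hj hij
      rw [forcingCoeff_of_ne hij]
      split_ifs with hjw
      · subst hjw
        obtain rfl : j = y := by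
          rcases Finset.mem_insert.1 hj with h | h
          · exact h
          · exact absurd h hwU
        rcases Finset.mem_insert.1 hi with h | h
        · exact absurd h hij
        · rw [nodeSign_of_mem_left hUQ h]
          norm_num
      · rw [add_zero]
  obtain ⟨x₀, hx₀⟩ : (U.erase v).Nonempty := by
    rw [← Finset.card_pos, Finset.card_erase_of_mem hv]
    omega
  obtain ⟨x₁, hx₁⟩ : ((U.erase v).erase x₀).Nonempty := by
    rw [← Finset.card_pos, Finset.card_erase_of_mem hx₀, Finset.card_erase_of_mem hv]
    omega
  obtain ⟨hx₁₀, hx₁⟩ := Finset.mem_erase.1 hx₁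
  set κ : ℝ := g x₀ v + g v x₁ - g x₀ x₁ with hκ
  have hins : ∀ y ∉ U, ∀ i ∈ insert y U, ∀ j ∈ insert y U, i ≠ v → j ≠ v → i ≠ j →
      g i j = g i v + g v j - κ := by
    intro y hy i hi j hj hiv hjv hij
    obtain ⟨κ', hκ'⟩ := exists_insertion_cost (G := g) (S := insert y U) (v := v) (γ := γ)
      (Finset.mem_insert_of_mem hv) (by rw [Finset.card_insert_of_notMem hy]; omega)
      (fun t h1 h2 => (hHam y hy t h1 h2).2)
    have h1 := hκ' x₀ (by simp at hx₀ ⊢; tauto) x₁ (by simp at hx₁ ⊢; tauto) hx₁₀.symm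
    have h2 := hκ' i (Finset.mem_erase.2 ⟨hiv, hi⟩) j (Finset.mem_erase.2 ⟨hjv, hj⟩) hij
    linarith
  set a : α → ℝ := fun i => if i = v then 0 else g i v - κ with ha
  set b : α → ℝ := fun j => if j = v then κ else g v j with hb
  have hab : ∀ y ∉ U, ∀ i ∈ insert y U, ∀ j ∈ insert y U, i ≠ j → g i j = a i + b j := by
    intro y hy i hi j hj hij
    by_cases hiv : i = v
    · subst hiv
      simp [ha, hb, hij.symm]
    · by_cases hjv : j = v
      · subst hjv
        simp [ha, hb, hiv]
      · simp only [ha, hb, hiv, hjv, if_false]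
        rw [hins y hy i hi j hj hiv hjv hij]
        ring
  have hsumQ : ∀ y ∉ U, (a y + b y) + ∑ i ∈ U, (a i + b i) = γ := by
    intro y hy
    have hS : (v :: ((insert y U).erase v).toList).toFinset = insert y U := by
      ext i
      simp
      grind
    have hn : (v :: ((insert y U).erase v).toList).Nodup := by
      simp [Finset.nodup_toList]
    obtain ⟨hne, h⟩ := hHam y hy _ hn hS
    rw [← h, pathWeight_eq_sum hn hne hS (hab y hy), Finset.sum_insert hy]
  have herase : ∀ u ∈ U.erase v, (v :: ((U.erase u).erase v).toList).Nodup ∧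
      ((U.erase u).erase v).toList.length + 1 = s ∧
      (v :: ((U.erase u).erase v).toList).toFinset = U.erase u := by
    intro u hu
    have hvu : v ∈ U.erase u := Finset.mem_erase.2 ⟨(Finset.mem_erase.1 hu).1.symm, hv⟩
    refine ⟨by simp [Finset.nodup_toList], ?_, ?_⟩
    · rw [Finset.length_toList, Finset.card_erase_of_mem hvu,
        Finset.card_erase_of_mem (Finset.mem_erase.1 hu).2]
      omega
    · ext i
      simp only [List.mem_toFinset, List.mem_cons, Finset.mem_toList, Finset.mem_erase] at hvu ⊢
      grind
  have hsumU : ∀ u ∈ U.erase v, ∑ i ∈ U, (a i + b i) - (a u + b u) = γ := by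
    intro u hu
    obtain ⟨hn, hlen, hS⟩ := herase u hu
    have hne : ((U.erase u).erase v).toList ≠ [] := by
      intro h
      rw [h, List.length_nil] at hlen
      omega
    have huU := (Finset.mem_erase.1 hu).2
    rw [← H _ hn (Or.inl hlen), pathWeight_eq_sum hn hne hS, Finset.sum_erase_eq_sub huU]
    · intro i hi j hj hij
      exact hab w hwU i (by simp at hi ⊢; tauto) j (by simp at hj ⊢; tauto) hij
    · rw [pathWeight_eq_sum (a := fun _ => 1) (b := fun _ => 0) hn hne hS]
      · rw [Finset.sum_const, Finset.card_erase_of_mem huU, hU]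
        simp
      · intro i hi j hj hij
        rw [forcingCoeff_of_ne hij, if_neg, nodeSign_of_mem_left hUQ (Finset.mem_erase.1 hi).2,
          add_zero]
        rintro rfl
        exact hwU (Finset.mem_erase.1 hj).2
  set l : ℝ := ∑ i ∈ U, (a i + b i) - γ with hl
  set σ : ℝ := a v + b v - l with hσ
  set π : α → ℝ := fun i => -b i - (if i = w then l else 0) with hπ
  have hγ : γ = l * s + σ := by
    have h1 : ∑ i ∈ U, (a i + b i) = (a v + b v) + ∑ i ∈ U.erase v, (a i + b i) :=
      (Finset.add_sum_erase U _ hv).symm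
    have h2 : ∑ i ∈ U.erase v, (a i + b i) = ∑ i ∈ U.erase v, l :=
      Finset.sum_congr rfl fun i hi => by linarith [hsumU i hi]
    rw [h2, Finset.sum_const, Finset.card_erase_of_mem hv, hU, nsmul_eq_mul,
      Nat.add_sub_cancel] at h1
    linarith
  refine ⟨l, σ, π, ?_⟩
  set d : α → α → ℝ := fun i j => (π i + if i = v then σ else 0) + -π j with hd
  set h : α → α → ℝ := fun i j => g i j - l * forcingCoeff U Q w i j - 1 * d i j with hh
  suffices hzero : ∀ i j, i ≠ j → h i j = 0 by
    intro i j hij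
    have := hzero i j hij
    simp only [hh, hd] at this
    linarith
  have hconst : ∀ t : List α, (v :: t).Nodup →
      (t.length + 1 = s ∨ t.length + 1 = s + 2 ∨ t.length + 1 = s + 4) →
      pathWeight (forcingCoeff U Q w) v t v = s → pathWeight h v t v = 0 := by
    intro t ht hlen hw
    have hvt := (List.nodup_cons.1 ht).1
    have hd0 : (t.map fun i => (π i + if i = v then σ else 0) + -π i) = t.map fun _ => 0 :=
      List.map_congr_left fun i hi => by
        rw [if_neg (ne_of_mem_of_not_mem hi hvt)]
        ring
    rw [hh, pathWeight_linear_comb, H t ht hlen hw, hw, hd, pathWeight_add_separable, hd0]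
    simp
    linarith
  have hbase : ∀ y ∉ U, ∀ i ∈ insert y U, ∀ j ∈ insert y U, i ≠ j → h i j = 0 := by
    intro y hy i hi j hj hij
    have hE : a i + b i = l * nodeSign U Q i - (if i = w then l else 0)
        + (if i = v then σ else 0) := by
      by_cases hiU : i ∈ U
      · rw [nodeSign_of_mem_left hUQ hiU, if_neg (ne_of_mem_of_not_mem hiU hwU)]
        split_ifs with hiv
        · rw [hiv, hσ]
          ring
        · linarith [hsumU i (Finset.mem_erase.2 ⟨hiv, hiU⟩)]
      · have := hsumQ i hiU
        rw [if_neg (hneU hiU)]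
        rcases hcover i with h | h | rfl
        · exact absurd h hiU
        · rw [nodeSign_of_mem_right hUQ h, if_neg (ne_of_mem_of_not_mem h hwQ)]
          linarith
        · rw [nodeSign_of_notMem hwU hwQ, if_pos rfl]
          linarith
    simp only [hh, hd, hπ]
    rw [hab y hy i hi j hj hij, forcingCoeff_of_ne hij]
    by_cases hjw : j = w
    · subst hjw
      obtain rfl : j = y := by
        rcases Finset.mem_insert.1 hj with h | h
        · exact h
        · exact absurd h hwU
      have hiU : i ∈ U := by
        rcases Finset.mem_insert.1 hi with h | h
        · exact absurd h hij
        · exact h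
      rw [nodeSign_of_mem_left hUQ hiU] at hE
      simp only [if_true, hij, if_false] at hE ⊢
      linarith
    · simp only [hjw, if_false]
      linarith
  have hleft : ∀ y ∈ Q, ∀ t : List α, (v :: t).Nodup → (∀ i ∈ t, i ∈ U) →
      pathWeight (forcingCoeff U Q w) v t y = t.length + 1 ∧ pathWeight h v t y = 0 := by
    intro y hy t ht htU
    have hyU : y ∉ U := Finset.disjoint_right.1 hUQ hy
    have hyt : y ∉ t := fun h => hyU (htU y h)
    have htU' : ∀ i ∈ v :: t, i ∈ U := by simpa [hv] using htU
    constructor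
    · rw [pathWeight_const (r := 1) ht hyt (fun _ => (hneU hyU).symm), mul_one]
      intro i hi j hj hij
      rw [forcingCoeff_of_ne hij, nodeSign_of_mem_left hUQ (htU' i hi), if_neg]
      rintro rfl
      rcases List.mem_cons.1 hj with h | h
      · exact hwQ (h ▸ hy)
      · exact hwU (htU j h)
    · rw [pathWeight_const (r := 0) ht hyt (fun _ => (hneU hyU).symm), mul_zero]
      intro i hi j hj hij
      refine hbase y hyU i (Finset.mem_insert_of_mem (htU' i hi)) j ?_ hij
      rcases List.mem_cons.1 hj with h | h
      · exact h ▸ Finset.mem_insert_self _ _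
      · exact Finset.mem_insert_of_mem (htU j h)
  have hwv : w ≠ v := hneU hwU
  have hwv0 : h w v = 0 := hbase w hwU w (by simp) v (by simp [hv]) hwv
  have hwcoeff : ∀ j ≠ w, forcingCoeff U Q w w j = 0 := fun j hj => by
    rw [forcingCoeff_of_ne hj.symm, if_neg hj, nodeSign_of_notMem hwU hwQ]
  have hqcoeff : ∀ i ∈ Q, forcingCoeff U Q w i w = 0 := fun i hi => by
    rw [forcingCoeff_of_ne (ne_of_mem_of_not_mem hi hwQ), if_pos rfl]
  have hQw : ∀ y ∈ Q, h y w = 0 := by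
    intro y hy
    obtain ⟨hn, hlen, -⟩ := herase x₀ hx₀
    set t := ((U.erase x₀).erase v).toList with ht
    have htU : ∀ i ∈ t, i ∈ U := fun i hi => by
      simp only [ht, Finset.mem_toList, Finset.mem_erase] at hi
      exact hi.2.2
    obtain ⟨h1, h2⟩ := hleft y hy t hn htU
    have hyU : y ∉ U := Finset.disjoint_right.1 hUQ hy
    have hyw : y ≠ w := ne_of_mem_of_not_mem hy hwQ
    have h3 := hconst (t ++ [y, w])
      (by
        have := htU y
        have := htU w
        simp only [List.nodup_cons, List.mem_cons, List.mem_append, List.nodup_append] at hn ⊢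
        grind)
      (by simp; omega)
      (by
        rw [pathWeight_append, h1]
        simp only [pathWeight]
        rw [hwcoeff v hwv.symm, hqcoeff y hy]
        have : (t.length : ℝ) + 1 = s := by exact_mod_cast hlen
        linarith)
    rw [pathWeight_append, h2] at h3
    simp only [pathWeight] at h3
    linarith
  have hn : (v :: (U.erase v).toList).Nodup := by simp [Finset.nodup_toList]
  have hlen : (U.erase v).toList.length = s := by
    rw [Finset.length_toList, Finset.card_erase_of_mem hv]
    omega
  set t := (U.erase v).toList with ht
  have htU : ∀ i ∈ t, i ∈ U := fun i hi => by
    simp only [ht, Finset.mem_toList, Finset.mem_erase] at hi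
    exact hi.2
  have hlen' : (t.length : ℝ) = s := by exact_mod_cast hlen
  have hqv : ∀ y ∈ Q, h y v = 0 := fun y hy =>
    have hyU : y ∉ U := Finset.disjoint_right.1 hUQ hy
    hbase y hyU y (by simp) v (by simp [hv]) (hneU hyU)
  have hqcoeff' : ∀ i ∈ Q, ∀ j, i ≠ j → j ≠ w → forcingCoeff U Q w i j = -1 :=
    fun i hi j hij hj => by
      rw [forcingCoeff_of_ne hij, if_neg hj, nodeSign_of_mem_right hUQ hi]
  have hQQ : ∀ y ∈ Q, ∀ z ∈ Q, y ≠ z → h w z = 0 ∧ h y z = 0 := by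
    intro y hy z hz hyz
    have hyU : y ∉ U := Finset.disjoint_right.1 hUQ hy
    have hzU : z ∉ U := Finset.disjoint_right.1 hUQ hz
    have hyw : y ≠ w := ne_of_mem_of_not_mem hy hwQ
    have hzw : z ≠ w := ne_of_mem_of_not_mem hz hwQ
    obtain ⟨h1, h2⟩ := hleft y hy t hn htU
    have hty := htU y
    have htz := htU z
    have htw := htU w
    have h3 := hconst (t ++ [y, w, z])
      (by
        simp only [List.nodup_cons, List.mem_cons, List.mem_append, List.nodup_append] at hn ⊢
        grind)
      (by simp; omega)
      (by
        rw [pathWeight_append, h1]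
        simp only [pathWeight]
        rw [hwcoeff z hzw, hqcoeff y hy, hqcoeff' z hz v (hneU hzU) hwv.symm]
        linarith)
    have h4 := hconst (t ++ [y, z, w])
      (by
        simp only [List.nodup_cons, List.mem_cons, List.mem_append, List.nodup_append] at hn ⊢
        grind)
      (by simp; omega)
      (by
        rw [pathWeight_append, h1]
        simp only [pathWeight]
        rw [hwcoeff v hwv.symm, hqcoeff z hz, hqcoeff' y hy z hyz hzw]
        linarith)
    rw [pathWeight_append, h2] at h3 h4
    simp only [pathWeight] at h3 h4
    rw [hQw y hy, hqv z hz] at h3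
    rw [hQw z hz, hwv0] at h4
    constructor <;> linarith
  intro i j hij
  by_cases hiU : i ∈ U
  · by_cases hjU : j ∈ U
    · exact hbase w hwU i (by simp [hiU]) j (by simp [hjU]) hij
    · exact hbase j hjU i (by simp [hiU]) j (by simp) hij
  by_cases hjU : j ∈ U
  · exact hbase i hiU i (by simp) j (by simp [hjU]) hij
  have hi := (hcover i).resolve_left hiU
  rcases (hcover j).resolve_left hjU with hj | rfl
  · rcases hi with hi | rfl
    · exact (hQQ i hi j hj hij).2
    · obtain ⟨y, hy⟩ : (Q.erase j).Nonempty := by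
        rw [← Finset.card_pos, Finset.card_erase_of_mem hj]
        omega
      exact (hQQ y (Finset.mem_erase.1 hy).2 j hj (Finset.mem_erase.1 hy).1).1
  · exact hQw i (hi.resolve_right hij)

end Forcing

/-- The linear functional on arc space with the given coefficients. -/
noncomputable def arcFunctional {n : ℕ} (G : Fin n → Fin n → ℝ) :
    (Fin n → Fin n → ℝ) →ₗ[ℝ] ℝ where
  toFun x := ∑ i, ∑ j, G i j * x i j
  map_add' x y := by simp [mul_add, Finset.sum_add_distrib]
  map_smul' r x := by simp [Finset.mul_sum, mul_left_comm]

section Polytope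

variable {n : ℕ}

lemma arcFunctional_apply (G x : Fin n → Fin n → ℝ) :
    arcFunctional G x = ∑ i, ∑ j, G i j * x i j := rfl

lemma exists_eq_arcFunctional (g : (Fin n → Fin n → ℝ) →ₗ[ℝ] ℝ) :
    ∃ G, g = arcFunctional G := by
  refine ⟨fun i j => g (Pi.single i (Pi.single j 1)), ?_⟩
  ext i j
  simp [arcFunctional_apply, Pi.single_apply, ite_apply, Finset.sum_ite_irrel]

lemma arcFunctional_incVec {k : ℕ} {f : Fin (k + 2) → Fin n} (hf : Function.Injective f)
    (G : Fin n → Fin n → ℝ) :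
    arcFunctional G (incVec (Finset.image (fun i => (f i, f (i + 1))) Finset.univ)) =
      ∑ i, G (f i) (f (i + 1)) := by
  have h : ∀ C : Finset (Fin n × Fin n), arcFunctional G (incVec C) = ∑ e ∈ C, G e.1 e.2 := by
    intro C
    rw [arcFunctional_apply, ← Finset.sum_product' (f := fun i j => G i j * incVec C i j)]
    simp [incVec]
  rw [h, Finset.sum_image]
  intro i _ j _ hij
  exact hf (Prod.ext_iff.1 hij).1

lemma card_image_arcs {k : ℕ} {f : Fin (k + 2) → Fin n} (hf : Function.Injective f) :
    (Finset.image (fun i => (f i, f (i + 1))) Finset.univ).card = k + 2 := by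
  rw [Finset.card_image_of_injective]
  · simp
  · intro i j hij
    exact hf (Prod.ext_iff.1 hij).1

/-- The closed walk through a list of distinct nodes is a simple cycle. -/
lemma exists_isSimpleCycle_of_nodup {x : Fin n} {t : List (Fin n)} (ht : (x :: t).Nodup)
    (hne : t ≠ []) :
    ∃ C : Finset (Fin n × Fin n), IsSimpleCycle C ∧ C.card = t.length + 1 ∧
      ∀ G, arcFunctional G (incVec C) = pathWeight G x t x := by
  obtain ⟨y, t, rfl⟩ := List.exists_cons_of_ne_nil hne
  set f : Fin (t.length + 2) → Fin n := Fin.cons x (y :: t).get with hf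
  have hinj : Function.Injective f := by
    rw [hf, Fin.cons_injective_iff, ← List.nodup_iff_injective_get]
    rw [List.nodup_cons] at ht
    refine ⟨?_, ht.2⟩
    rintro ⟨i, hi⟩
    exact ht.1 (hi ▸ List.get_mem _ _)
  refine ⟨_, ⟨t.length, f, hinj, rfl⟩, card_image_arcs hinj, fun G => ?_⟩
  have h := pathWeight_ofFn G (t.length + 1) f x
  have h0 : f 0 = x := rfl
  have h1 : (List.ofFn fun i : Fin (t.length + 1) => f i.succ) = y :: t :=
    List.ofFn_get (y :: t)
  rw [h0, h1] at h
  rw [arcFunctional_incVec hinj, h, Fin.sum_univ_castSucc]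
  simp [h0]

variable {m : ℕ} {c : Fin m → ℕ}

lemma arcFunctional_le_of_mem_cyclePolytope {G : Fin n → Fin n → ℝ} {b : ℝ}
    (h : ∀ (k : ℕ) (f : Fin (k + 2) → Fin n), Function.Injective f → (∃ p, k + 2 = c p) →
      ∑ i, G (f i) (f (i + 1)) ≤ b) {x : Fin n → Fin n → ℝ} (hx : x ∈ cyclePolytope n c) :
    arcFunctional G x ≤ b := by
  refine convexHull_min (t := {x | arcFunctional G x ≤ b}) ?_
    (convex_halfSpace_le (arcFunctional G).isLinear b) hx
  rintro _ ⟨_, ⟨k, f, hf, rfl⟩, ⟨p, hp⟩, rfl⟩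
  rw [card_image_arcs hf] at hp
  change arcFunctional G _ ≤ b
  rw [arcFunctional_incVec hf]
  exact h k f hf ⟨p, hp⟩

/-- Points of the cycle polytope vanish on loops and conserve flow. -/
lemma arcFunctional_eq_zero_of_mem_cyclePolytope {G : Fin n → Fin n → ℝ} {π : Fin n → ℝ}
    (h : ∀ i j, i ≠ j → G i j = π i - π j) {x : Fin n → Fin n → ℝ}
    (hx : x ∈ cyclePolytope n c) : arcFunctional G x = 0 := by
  have hsum : ∀ (k : ℕ) (f : Fin (k + 2) → Fin n), Function.Injective f →
      ∑ i, G (f i) (f (i + 1)) = 0 := by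
    intro k f hf
    rw [Finset.sum_congr rfl fun i _ => h _ _ (hf.ne (by simp)), Finset.sum_sub_distrib,
      sub_eq_zero]
    exact (Equiv.sum_comp (Equiv.addRight (1 : Fin (k + 2))) fun i => π (f i)).symm
  have h1 := arcFunctional_le_of_mem_cyclePolytope (G := G) (b := 0)
    (fun k f hf _ => (hsum k f hf).le) hx
  have h2 := arcFunctional_le_of_mem_cyclePolytope (G := fun i j => -G i j) (b := 0)
    (fun k f hf _ => by rw [Finset.sum_neg_distrib, hsum k f hf, neg_zero]) hx
  simp only [arcFunctional_apply, neg_mul, Finset.sum_neg_distrib] at h1 h2 ⊢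
  linarith

lemma outSum_eq_arcFunctional (x : Fin n → Fin n → ℝ) (v : Fin n) :
    outSum x v = arcFunctional (fun i j => if i = v ∧ j ≠ v then 1 else 0) x := by
  have h : ∀ i, (∑ j, (if i = v ∧ j ≠ v then 1 else 0) * x i j) =
      if i = v then outSum x v else 0 := by
    intro i
    split_ifs with hi
    · subst hi
      simp [outSum, Finset.sum_ite, ← Finset.filter_ne']
    · simp [hi]
  rw [arcFunctional_apply, Finset.sum_congr rfl fun i _ => h i]
  simp

lemma forcing_eq_arcFunctional (U Q : Finset (Fin n)) (w : Fin n) (x : Fin n → Fin n → ℝ) :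
    (∑ v ∈ U, outSum x v) - (∑ v ∈ Q, outSum x v) + (∑ j ∈ Q, x j w) - (∑ i ∈ U, x i w) =
      arcFunctional (forcingCoeff U Q w) x := by
  have hsign : ∀ y : Fin n → ℝ,
      ∑ i, nodeSign U Q i * y i = ∑ i ∈ U, y i - ∑ i ∈ Q, y i := by
    intro y
    simp [nodeSign, sub_mul, Finset.sum_sub_distrib]
  have h : ∀ i, ∑ j, forcingCoeff U Q w i j * x i j =
      nodeSign U Q i * outSum x i - nodeSign U Q i * x i w := by
    intro i
    have h1 : ∑ j, (if j = i then 0 else nodeSign U Q i) * x i j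
        = nodeSign U Q i * outSum x i := by
      rw [outSum, Finset.mul_sum, ← Finset.filter_ne', Finset.sum_filter]
      refine Finset.sum_congr rfl fun j _ => ?_
      by_cases hj : j = i <;> simp [hj]
    rw [← h1]
    simp [forcingCoeff, sub_mul, Finset.sum_sub_distrib]
  rw [arcFunctional_apply, Finset.sum_congr rfl fun i _ => h i, Finset.sum_sub_distrib, hsign,
    hsign]
  ring

/-- Validity of the modified cardinality forcing inequality on a simple cycle whose number of
arcs is neither `s + 1` nor `s + 3`. -/
lemma sum_forcingCoeff_le {U Q : Finset (Fin n)} {w : Fin n} {s : ℕ} (hUQ : Disjoint U Q)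
    (hwU : w ∉ U) (hwQ : w ∉ Q) (hcover : ∀ i, i ∈ U ∨ i ∈ Q ∨ i = w) (hU : U.card = s + 1)
    {k : ℕ} {f : Fin (k + 2) → Fin n} (hf : Function.Injective f) (hk1 : k + 2 ≠ s + 1)
    (hk3 : k + 2 ≠ s + 3) : ∑ i, forcingCoeff U Q w (f i) (f (i + 1)) ≤ s := by
  set X := Finset.image f Finset.univ with hX
  have hXcard : X.card = k + 2 := by
    rw [hX, Finset.card_image_of_injective _ hf]
    simp
  have hXsplit : X.card = (X ∩ U).card + (X ∩ Q).card + (X ∩ {w}).card := by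
    rw [← Finset.card_union_of_disjoint, ← Finset.card_union_of_disjoint]
    · congr 1
      ext i
      have := hcover i
      simp only [Finset.mem_union, Finset.mem_inter, Finset.mem_singleton]
      tauto
    · rw [Finset.disjoint_left]
      intro i
      simp only [Finset.mem_union, Finset.mem_inter, Finset.mem_singleton]
      rintro h ⟨-, rfl⟩
      tauto
    · exact hUQ.mono Finset.inter_subset_right Finset.inter_subset_right
  have hsum : ∑ i, nodeSign U Q (f i) = (X ∩ U).card - (X ∩ Q).card := by
    rw [← Finset.sum_image (s := Finset.univ) (g := f) (f := nodeSign U Q) hf.injOn, ← hX]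
    simp [nodeSign, Finset.sum_sub_distrib]
  have hUle : (X ∩ U).card ≤ s + 1 := hU ▸ Finset.card_le_card Finset.inter_subset_right
  have hcoeff : ∀ i, forcingCoeff U Q w (f i) (f (i + 1)) =
      nodeSign U Q (f i) - if f (i + 1) = w then nodeSign U Q (f i) else 0 := by
    intro i
    rw [forcingCoeff, if_neg (hf.ne (by simp))]
  rw [Finset.sum_congr rfl fun i _ => hcoeff i, Finset.sum_sub_distrib, hsum]
  by_cases hw : w ∈ X
  · obtain ⟨i₁, -, hi₁⟩ := Finset.mem_image.1 hw
    have hpred : ∀ i, f (i + 1) = w ↔ i = i₁ - 1 := by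
      intro i
      rw [← hi₁, hf.eq_iff, eq_sub_iff_add_eq]
    simp only [hpred, Finset.sum_ite_eq', Finset.mem_univ, if_true]
    have hne : f (i₁ - 1) ≠ w := by
      rw [← hi₁]
      exact hf.ne (by simp)
    have hw1 : (X ∩ {w}).card = 1 := by
      rw [Finset.inter_singleton_of_mem hw, Finset.card_singleton]
    rcases hcover (f (i₁ - 1)) with h | h | h
    · rw [nodeSign_of_mem_left hUQ h]
      have : ((X ∩ U).card : ℝ) ≤ s + 1 := by exact_mod_cast hUle
      have : (0 : ℝ) ≤ (X ∩ Q).card := Nat.cast_nonneg _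
      linarith
    · rw [nodeSign_of_mem_right hUQ h]
      have hpos : 0 < (X ∩ Q).card := Finset.card_pos.2
        ⟨_, Finset.mem_inter.2 ⟨Finset.mem_image_of_mem f (Finset.mem_univ _), h⟩⟩
      have : (X ∩ U).card + 1 ≤ s + (X ∩ Q).card := by omega
      have : ((X ∩ U).card : ℝ) + 1 ≤ s + (X ∩ Q).card := by exact_mod_cast this
      linarith
    · exact absurd h hne
  · have hno : ∀ i, f (i + 1) ≠ w := fun i h =>
      hw (h ▸ Finset.mem_image_of_mem f (Finset.mem_univ _))
    have hw0 : (X ∩ {w}).card = 0 := by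
      rw [Finset.inter_singleton_of_notMem hw, Finset.card_empty]
    simp only [hno, if_false, Finset.sum_const_zero, sub_zero]
    have : (X ∩ U).card ≤ s + (X ∩ Q).card := by omega
    have : ((X ∩ U).card : ℝ) ≤ s + (X ∩ Q).card := by exact_mod_cast this
    linarith

end Polytope

/-- A face of `P` cut out by `φ = b` has codimension one if `P` is not contained in it and every
functional constant on the face is, on `P`, an affine function of `φ`. -/
lemma adim_face_add_one {V : Type*} [AddCommGroup V] [Module ℝ V] [FiniteDimensional ℝ V]
    {P : Set V} {φ : V →ₗ[ℝ] ℝ} {b : ℝ} {x₀ x₁ : V} (hx₀ : x₀ ∈ P) (hφ₀ : φ x₀ = b)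
    (hx₁ : x₁ ∈ P) (hφ₁ : φ x₁ ≠ b)
    (h : ∀ g : V →ₗ[ℝ] ℝ, (∀ x ∈ P, φ x = b → g x = g x₀) →
      ∃ l r : ℝ, ∀ x ∈ P, g x = l * φ x + r) :
    adim {x ∈ P | φ x = b} + 1 = adim P := by
  set F := {x ∈ P | φ x = b} with hF
  set z := x₁ - x₀ with hz
  have hφz : φ z ≠ 0 := by
    rw [hz, map_sub, hφ₀]
    exact sub_ne_zero.2 hφ₁
  have hx₀F : x₀ ∈ F := ⟨hx₀, hφ₀⟩
  have hker : vectorSpan ℝ F ≤ LinearMap.ker φ := by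
    rw [vectorSpan_eq_span_vsub_set_right ℝ hx₀F, Submodule.span_le]
    rintro _ ⟨x, hx, rfl⟩
    simp [hx.2, hφ₀]
  have hsup : vectorSpan ℝ F ⊔ Submodule.span ℝ {z} = vectorSpan ℝ P := by
    refine le_antisymm (sup_le (vectorSpan_mono ℝ (Set.sep_subset _ _)) ?_) ?_
    · rw [Submodule.span_singleton_le_iff_mem]
      exact vsub_mem_vectorSpan ℝ hx₁ hx₀
    · intro y hy
      by_contra hy'
      obtain ⟨g, hgy, hg⟩ := Submodule.exists_le_ker_of_notMem hy'
      have hgz : g z = 0 := hg (Submodule.mem_sup_right (Submodule.mem_span_singleton_self z))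
      obtain ⟨l, r, hlr⟩ := h g fun x hx hφx => by
        have := hg (Submodule.mem_sup_left (vsub_mem_vectorSpan ℝ (⟨hx, hφx⟩ : x ∈ F) hx₀F))
        simpa [sub_eq_zero] using this
      have hl : l = 0 := by
        rw [hz, map_sub, hlr _ hx₁, hlr _ hx₀, add_sub_add_right_eq_sub, ← mul_sub,
          ← map_sub] at hgz
        exact (mul_eq_zero.1 hgz).resolve_right hφz
      have hP : vectorSpan ℝ P ≤ LinearMap.ker g := by
        rw [vectorSpan_eq_span_vsub_set_right ℝ hx₀, Submodule.span_le]
        rintro _ ⟨x, hx, rfl⟩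
        simp [hlr x hx, hlr _ hx₀, hl]
      exact hgy (hP hy)
  have hinf : vectorSpan ℝ F ⊓ Submodule.span ℝ {z} = ⊥ := by
    rw [eq_bot_iff]
    rintro y ⟨hy, hy'⟩
    obtain ⟨r, rfl⟩ := Submodule.mem_span_singleton.1 hy'
    have h0 : φ (r • z) = 0 := hker hy
    rw [map_smul, smul_eq_mul] at h0
    simp [(mul_eq_zero.1 h0).resolve_right hφz]
  have hz0 : z ≠ 0 := fun h => hφz (by rw [h, map_zero])
  have hdim := Submodule.finrank_sup_add_finrank_inf_eq (vectorSpan ℝ F) (Submodule.span ℝ {z})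
  rw [hsup, hinf, finrank_bot, finrank_span_singleton hz0, add_zero] at hdim
  exact hdim.symm

/-- **Theorem 12 (modified cardinality forcing inequalities).**  Let `D_n` be the
complete digraph on `n ≥ 6` nodes and `c` a cardinality sequence with `m ≥ 3`,
`2 ≤ c 0 < ⋯ < c (m-1) ≤ n`, and `c r = c q + 2 = c p + 4` for consecutive indices
`p, q, r` with `p` neither the first index nor among the last two.  Let
`N = U ∪̇ Q ∪̇ {w}` be a partition of the nodes with `v₀ ∈ U` (where `v₀` is the first
node, the node "1") and `|U| = c p + 1 = c q − 1`.  Then the modified cardinality forcing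
inequality
`Σ_{v∈U} x(δ^out(v)) − Σ_{v∈Q} x(δ^out(v)) + x((Q:{w})) − x((U:{w})) ≤ c p`
is valid for `P* = {x ∈ P_C^c(D_n) : x(δ^out(v₀)) = 1}` and defines a facet of `P*`. -/
theorem modified_cardinality_forcing_facet_Pstar (n m : ℕ) (hn : 6 ≤ n) (hm : 3 ≤ m)
    (c : Fin m → ℕ) (hmono : StrictMono c)
    (hc2 : ∀ p, 2 ≤ c p) (hcn : ∀ p, c p ≤ n)
    (p q r : Fin m) (hq : (q : ℕ) = (p : ℕ) + 1) (hr : (r : ℕ) = (p : ℕ) + 2)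
    (hp1 : 1 ≤ (p : ℕ))
    (hcq : c q = c p + 2) (hcr : c r = c p + 4)
    (v₀ : Fin n) (hv₀ : (v₀ : ℕ) = 0)
    (U Q : Finset (Fin n)) (w : Fin n)
    (hUQ : Disjoint U Q) (hwU : w ∉ U) (hwQ : w ∉ Q)
    (hcover : U ∪ Q ∪ {w} = Finset.univ)
    (hv₀U : v₀ ∈ U) (hUcard : U.card = c p + 1) :
    IsFacetLE {x ∈ cyclePolytope n c | outSum x v₀ = 1}
      (fun x => (∑ v ∈ U, outSum x v) - (∑ v ∈ Q, outSum x v)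
        + (∑ j ∈ Q, x j w) - (∑ i ∈ U, x i w))
      (c p : ℝ) := by
  have hcover' : ∀ i, i ∈ U ∨ i ∈ Q ∨ i = w := by
    intro i
    have := Finset.mem_univ i
    rw [← hcover] at this
    simp at this
    tauto
  have hU2 : c p ≤ U.card := by omega
  have hs : c ⟨0, by omega⟩ < c p := hmono (Fin.lt_def.2 hp1)
  have hs3 : 3 ≤ c p := by
    have := hc2 ⟨0, by omega⟩
    omega
  have hQ2 : 2 ≤ Q.card := by
    have h1 := congrArg Finset.card hcover
    rw [Finset.card_union_of_disjoint (by simp [hwU, hwQ]), Finset.card_union_of_disjoint hUQ,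
      Finset.card_singleton, Finset.card_univ, Fintype.card_fin] at h1
    have := hcn r
    omega
  have hgap : ∀ i, c i ≠ c p + 1 ∧ c i ≠ c p + 3 := by
    intro i
    rcases lt_or_ge p i with h | h
    · have h1 : c q ≤ c i := hmono.monotone (Fin.le_def.2 (by rw [Fin.lt_def] at h; omega))
      rcases lt_or_ge q i with h' | h'
      · have h2 : c r ≤ c i := hmono.monotone (Fin.le_def.2 (by rw [Fin.lt_def] at h'; omega))
        omega
      · have h2 : c i ≤ c q := hmono.monotone h'
        omega
    · have h1 : c i ≤ c p := hmono.monotone h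
      omega
  have hcycle : ∀ t : List (Fin n), (v₀ :: t).Nodup → (∃ i, t.length + 1 = c i) →
      ∃ x ∈ {x ∈ cyclePolytope n c | outSum x v₀ = 1},
        ∀ G, arcFunctional G x = pathWeight G v₀ t v₀ := by
    rintro t ht ⟨i, hi⟩
    have hne : t ≠ [] := by
      rintro rfl
      have := hc2 i
      simp only [List.length_nil] at hi
      omega
    obtain ⟨C, hC, hcard, hG⟩ := exists_isSimpleCycle_of_nodup ht hne
    refine ⟨incVec C, ⟨subset_convexHull ℝ _ ⟨C, hC, ⟨i, hcard.trans hi⟩, rfl⟩, ?_⟩, hG⟩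
    rw [outSum_eq_arcFunctional, hG, pathWeight_eq_sum (a := fun i => if i = v₀ then 1 else 0)
      (b := fun _ => 0) ht hne rfl]
    · simp
    · intro i _ j _ hij
      have : i = v₀ ∧ j ≠ v₀ ↔ i = v₀ := by grind
      simp [this]
  have hshort : ∀ i, c i ≤ c p → ∃ x ∈ {x ∈ cyclePolytope n c | outSum x v₀ = 1},
      arcFunctional (forcingCoeff U Q w) x = c i := by
    intro i hi
    have h2 := hc2 i
    obtain ⟨T, hT, hTcard⟩ := Finset.exists_subset_card_eq (s := U.erase v₀) (n := c i - 1)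
      (by rw [Finset.card_erase_of_mem hv₀U]; omega)
    have hvT : v₀ ∉ T := fun h => by simpa using hT h
    have hn' : (v₀ :: T.toList).Nodup := by simp [Finset.nodup_toList, hvT]
    have hlen : T.toList.length + 1 = c i := by
      rw [Finset.length_toList]
      omega
    have hTU : ∀ j ∈ v₀ :: T.toList, j ∈ U := by
      intro j hj
      rcases List.mem_cons.1 hj with rfl | hj
      · exact hv₀U
      · exact Finset.mem_of_mem_erase (hT (Finset.mem_toList.1 hj))
    obtain ⟨x, hx, hG⟩ := hcycle _ hn' ⟨i, hlen⟩
    refine ⟨x, hx, ?_⟩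
    rw [hG, pathWeight_const (r := 1) hn' (by simpa using hvT), mul_one]
    · exact_mod_cast hlen
    · intro h
      rw [h, List.length_nil] at hlen
      omega
    · intro a ha b hb hab
      rw [forcingCoeff_of_ne hab, if_neg (ne_of_mem_of_not_mem (hTU b hb) hwU),
        nodeSign_of_mem_left hUQ (hTU a ha)]
  simp only [forcing_eq_arcFunctional]
  refine ⟨fun x hx => arcFunctional_le_of_mem_cyclePolytope ?_ hx.1, ?_⟩
  · rintro k f hf ⟨i, hi⟩
    exact sum_forcingCoeff_le hUQ hwU hwQ hcover' hUcard hf (hi ▸ (hgap i).1) (hi ▸ (hgap i).2)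
  obtain ⟨x₀, hx₀, hφ₀⟩ := hshort p le_rfl
  obtain ⟨x₁, hx₁, hφ₁⟩ := hshort _ hs.le
  refine adim_face_add_one hx₀ hφ₀ hx₁ (by rw [hφ₁]; exact_mod_cast hs.ne) fun g hg => ?_
  obtain ⟨G, rfl⟩ := exists_eq_arcFunctional g
  obtain ⟨l, σ, π, hG⟩ := exists_combination_of_const_on_tight (v := v₀) hUQ hwU hwQ hcover'
    hv₀U hUcard hs3 hQ2 (g := G) (γ := arcFunctional G x₀) (by
      intro t ht hlen htight
      obtain ⟨x, hx, hGx⟩ := hcycle t ht (by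
        rcases hlen with h | h | h
        · exact ⟨p, h⟩
        · exact ⟨q, h.trans hcq.symm⟩
        · exact ⟨r, h.trans hcr.symm⟩)
      rw [← hGx]
      exact hg x hx (by rw [hGx, htight]))
  refine ⟨l, σ, fun x hx => ?_⟩
  have hzero := arcFunctional_eq_zero_of_mem_cyclePolytope (π := π)
    (G := fun i j => G i j - l * forcingCoeff U Q w i j
      - σ * (if i = v₀ ∧ j ≠ v₀ then 1 else 0)) (by
      intro i j hij
      have : i = v₀ ∧ j ≠ v₀ ↔ i = v₀ := by grind
      simp only [hG i j hij, this]
      split_ifs <;> ring) hx.1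
  have hout := hx.2
  rw [outSum_eq_arcFunctional] at hout
  have hsplit : ∑ i, ∑ j, (G i j - l * forcingCoeff U Q w i j
      - σ * (if i = v₀ ∧ j ≠ v₀ then 1 else 0)) * x i j =
      arcFunctional G x - l * arcFunctional (forcingCoeff U Q w) x
        - σ * arcFunctional (fun i j => if i = v₀ ∧ j ≠ v₀ then 1 else 0) x := by
    simp only [arcFunctional_apply, sub_mul, Finset.sum_sub_distrib, Finset.mul_sum, mul_assoc]
  rw [arcFunctional_apply, hsplit, hout] at hzero
  linarith
end

section
/- Let K_{n+1} = (N, E) be the complete (undirected) graph on node set N = {0,…,n} with n ≥ 4, and let c = (c_1,…,c_m) be a cardinality sequence in CS (i.e. m ≥ 2, 2 ≤ c_1 < ⋯ < c_m ≤ n, and c ≠ (2,3)). Then the dimension of the undirected cardinality constrained path polytope P_{0,n-path}^c(K_{n+1}) equals |E| − 3 = n(n+1)/2 − 3. -/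
open Finset

/-- A simple `(0,n)`-path in the complete undirected graph `K_{n+1}` on the node set
`{0,1,…,n} = Fin (n+1)`, encoded by its edge set: there is an injective map `f` from
`Fin (k+1)` to the nodes with `f 0 = 0` and `f k = n` whose consecutive unordered pairs
are exactly the edges of `P` (so `P` has `k` edges). -/
def IsUPath (n : ℕ) (P : Finset (Sym2 (Fin (n + 1)))) : Prop :=
  ∃ (k : ℕ) (f : Fin (k + 1) → Fin (n + 1)), Function.Injective f ∧
    f 0 = 0 ∧ f (Fin.last k) = Fin.last n ∧
    P = Finset.image (fun i : Fin k => s(f (Fin.castSucc i), f (Fin.succ i)))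
      Finset.univ

/-- Incidence vector of an edge set. -/
noncomputable def uIncVec {n : ℕ} (P : Finset (Sym2 (Fin (n + 1)))) :
    Sym2 (Fin (n + 1)) → ℝ :=
  fun e => if e ∈ P then 1 else 0

/-- The undirected cardinality constrained `(0,n)`-path polytope
`P_{0,n-path}^c(K_{n+1})`: the convex hull of the incidence vectors of simple
`(0,n)`-paths whose cardinality is `c p` for some `p`. -/
noncomputable def uPathPolytope (n : ℕ) {m : ℕ} (c : Fin m → ℕ) :
    Set (Sym2 (Fin (n + 1)) → ℝ) :=
  convexHull ℝ {x | ∃ P, IsUPath n P ∧ (∃ p, P.card = c p) ∧ x = uIncVec P}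

/-- The functional with weights `u`, `w`, `v` (first node, edges, last node) takes the value `b`
on every sequence of `r + 1` distinct nodes of `V`. -/
def IsConstOnPaths {V : Type*} (u v : V → ℝ) (w : V → V → ℝ) (b : ℝ) (r : ℕ) : Prop :=
  ∀ f : ℕ → V, Set.InjOn f (Set.Iio (r + 1)) →
    u (f 0) + v (f r) + ∑ i ∈ range r, w (f i) (f (i + 1)) = b

lemma exists_injOn_Iio_apply_eq {V : Type*} [Fintype V] {L m : ℕ}
    (hL : L ≤ Fintype.card V) (hm0 : 0 < m) (hmL : m < L) {x y : V} (hxy : x ≠ y) :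
    ∃ f : ℕ → V, Set.InjOn f (Set.Iio L) ∧ f 0 = x ∧ f m = y := by
  classical
  obtain ⟨e⟩ : Nonempty (Fin L ↪ V) :=
    Function.Embedding.nonempty_of_card_le (by simpa using hL)
  let g : ℕ → V := fun i => if h : i < L then e ⟨i, h⟩ else x
  have hg : Set.InjOn g (Set.Iio L) := by
    intro i hi j hj h
    simp only [Set.mem_Iio] at hi hj
    simpa [g, hi, hj] using h
  let σ := Equiv.swap (g 0) x
  let τ := Equiv.swap (σ (g m)) y
  have h0m : g 0 ≠ g m := fun h => hm0.ne (hg (Set.mem_Iio.2 (by omega)) hmL h)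
  have hσ : σ (g 0) = x := Equiv.swap_apply_left _ _
  refine ⟨fun i => τ (σ (g i)), ?_, ?_, Equiv.swap_apply_left _ _⟩
  · exact fun i hi j hj h => hg hi hj (σ.injective (τ.injective h))
  · change τ (σ (g 0)) = x
    rw [hσ]
    refine Equiv.swap_apply_of_ne_of_ne (fun h => h0m (σ.injective ?_)) hxy
    rw [hσ, h]

lemma injOn_mod_add {V : Type*} {L M : ℕ} (hML : M ≤ L) {f : ℕ → V}
    (hf : Set.InjOn f (Set.Iio L)) (j : ℕ) :
    Set.InjOn (fun i => f ((j + i) % L)) (Set.Iio M) := by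
  intro i hi i' hi' h
  simp only [Set.mem_Iio] at hi hi'
  have hL : 0 < L := by omega
  have h1 : j + i ≡ j + i' [MOD L] := hf (Nat.mod_lt _ hL) (Nat.mod_lt _ hL) h
  exact (Nat.ModEq.add_left_cancel' j h1).eq_of_lt_of_lt (by omega) (by omega)

/-- Summing a periodic function over a full period does not depend on the starting point. -/
lemma sum_range_add_of_periodic {h : ℕ → ℝ} {L : ℕ} (hp : Function.Periodic h L) (j : ℕ) :
    ∑ i ∈ range L, h (j + i) = ∑ i ∈ range L, h i := by
  induction j with
  | zero => simp
  | succ j ih =>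
    rw [← ih]
    have h1 := sum_range_succ (fun i => h (j + i)) L
    have h2 := sum_range_succ' (fun i => h (j + i)) L
    have h3 : ∀ i, j + 1 + i = j + (i + 1) := by intro i; ring
    simp only [h3]
    have h4 := hp j
    simp only [add_zero] at h1 h2
    linarith

/-- Along a cyclic arrangement of `r + 1` nodes, the edge weights are determined by the
end weights up to an additive constant. -/
lemma IsConstOnPaths.exists_cycle_weight {V : Type*} {u v : V → ℝ} {w : V → V → ℝ} {b : ℝ}
    {r : ℕ} (H : IsConstOnPaths u v w b r) {f : ℕ → V} (hf : Set.InjOn f (Set.Iio (r + 1))) :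
    ∃ t : ℝ, ∀ m, w (f (m % (r + 1))) (f ((m + 1) % (r + 1))) =
      u (f ((m + 1) % (r + 1))) + v (f (m % (r + 1))) + t := by
  let h : ℕ → ℝ := fun m => w (f (m % (r + 1))) (f ((m + 1) % (r + 1)))
  have hp : Function.Periodic h (r + 1) := by
    intro m
    have h1 : (m + (r + 1) + 1) % (r + 1) = (m + 1) % (r + 1) := by
      rw [show m + (r + 1) + 1 = m + 1 + (r + 1) by ring, Nat.add_mod_right]
    simp only [h, h1, Nat.add_mod_right]
  refine ⟨∑ i ∈ range (r + 1), h i - b, fun m => ?_⟩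
  have h1 := H _ (injOn_mod_add le_rfl hf (m + 1))
  have h2 := sum_range_add_of_periodic hp (m + 1)
  rw [sum_range_succ] at h2
  have h3 : m + 1 + r = m + (r + 1) := by ring
  rw [h3, hp m] at h2
  simp only [h3, Nat.add_mod_right, add_zero] at h1
  have h4 : ∑ i ∈ range r, w (f ((m + 1 + i) % (r + 1))) (f ((m + 1 + (i + 1)) % (r + 1))) =
      ∑ i ∈ range r, h (m + 1 + i) := rfl
  rw [h4] at h1
  change h m = _
  linarith

lemma IsConstOnPaths.sum_window {V : Type*} {u v : V → ℝ} {w : V → V → ℝ} {b t : ℝ} {k : ℕ}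
    (H : IsConstOnPaths u v w b k) {F : ℕ → V}
    (hF : ∀ m, w (F m) (F (m + 1)) = u (F (m + 1)) + v (F m) + t) (j : ℕ)
    (hinj : Set.InjOn (fun i => F (j + i)) (Set.Iio (k + 1))) :
    ∑ i ∈ range (k + 1), (u (F (j + i)) + v (F (j + i))) + k * t = b := by
  have h1 := H _ hinj
  simp only [← add_assoc, hF, sum_add_distrib, sum_const, card_range, nsmul_eq_mul] at h1
  rw [sum_add_distrib, sum_range_succ', sum_range_succ (fun i => v (F (j + i)))]
  simp only [← add_assoc] at h1 ⊢
  linarith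

lemma IsConstOnPaths.sub_eq_sub {V : Type*} [Fintype V] {u v : V → ℝ} {w : V → V → ℝ} {b : ℝ}
    {r : ℕ} (hw : ∀ x y, w x y = w y x) (H : IsConstOnPaths u v w b r) (hr : 0 < r)
    (hV : r + 1 ≤ Fintype.card V) (x y : V) : u x - v x = u y - v y := by
  by_cases hxy : x = y
  · rw [hxy]
  obtain ⟨f, hf, rfl, rfl⟩ := exists_injOn_Iio_apply_eq hV hr (Nat.lt_succ_self r) hxy
  have h1 := H f hf
  have h2 := H (fun i => f (r - i)) (fun i hi j hj h => by
    simp only [Set.mem_Iio] at hi hj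
    have := hf (Set.mem_Iio.2 (by omega)) (Set.mem_Iio.2 (by omega)) h
    omega)
  have h3 : ∑ i ∈ range r, w (f (r - i)) (f (r - (i + 1))) =
      ∑ i ∈ range r, w (f i) (f (i + 1)) := by
    rw [← sum_range_reflect]
    refine sum_congr rfl fun i hi => ?_
    rw [mem_range] at hi
    rw [hw, show r - (r - 1 - i + 1) = i by omega, show r - (r - 1 - i) = i + 1 by omega]
  simp only [Nat.sub_zero, Nat.sub_self, h3] at h2
  linarith

/-- A functional that is constant on the node sequences of two different lengths, the larger one
at least three, is trivial. -/
lemma IsConstOnPaths.trivial {V : Type*} [Fintype V] {u v : V → ℝ} {w : V → V → ℝ} {b : ℝ}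
    {k r : ℕ} (hw : ∀ x y, w x y = w y x) (hk : IsConstOnPaths u v w b k)
    (hr : IsConstOnPaths u v w b r) (hkr : k < r) (hr2 : 2 ≤ r) (hV : r + 1 ≤ Fintype.card V) :
    (∀ x y, u x = u y) ∧ (∀ x y, v x = v y) ∧ ∀ x y, x ≠ y → w x y = 0 := by
  have hsub := hr.sub_eq_sub hw (by omega) hV
  have hadd : ∀ x y, u x + v x = u y + v y := by
    intro x y
    by_cases hxy : x = y
    · rw [hxy]
    obtain ⟨f, hf, rfl, rfl⟩ :=
      exists_injOn_Iio_apply_eq hV (Nat.succ_pos k) (by omega : k + 1 < r + 1) hxy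
    obtain ⟨t, ht⟩ := hr.exists_cycle_weight hf
    have h0 := hk.sum_window (F := fun i => f (i % (r + 1))) ht 0
      (injOn_mod_add (by omega) hf 0)
    have h1 := hk.sum_window (F := fun i => f (i % (r + 1))) ht 1
      (injOn_mod_add (by omega) hf 1)
    rw [sum_range_succ'] at h0
    rw [sum_range_succ] at h1
    simp only [zero_add, add_comm 1, Nat.zero_mod, Nat.mod_eq_of_lt (by omega : k + 1 < r + 1)]
      at h0 h1
    linarith
  have hu : ∀ x y, u x = u y := fun x y => by linarith [hsub x y, hadd x y]
  have hv : ∀ x y, v x = v y := fun x y => by linarith [hsub x y, hadd x y]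
  refine ⟨hu, hv, fun x y hxy => ?_⟩
  obtain ⟨f, hf, rfl, rfl⟩ := exists_injOn_Iio_apply_eq hV one_pos (by omega : 1 < r + 1) hxy
  obtain ⟨t, ht⟩ := hr.exists_cycle_weight hf
  have h0 := hk.sum_window (F := fun i => f (i % (r + 1))) ht 0 (injOn_mod_add (by omega) hf 0)
  have h1 := hr.sum_window (F := fun i => f (i % (r + 1))) ht 0 (injOn_mod_add le_rfl hf 0)
  have h2 := ht 0
  simp only [fun i => hadd (f ((0 + i) % (r + 1))) (f 0), sum_const, card_range, nsmul_eq_mul]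
    at h0 h1
  simp only [Nat.zero_mod, zero_add, Nat.mod_eq_of_lt (by omega : 1 < r + 1)] at h2
  have h3 : ((r : ℝ) - k) * (u (f 0) + v (f 0) + t) = 0 := by
    push_cast at h0 h1
    linear_combination h1 - h0
  have h4 : (r : ℝ) - k ≠ 0 := sub_ne_zero.2 (by exact_mod_cast hkr.ne')
  have h5 := (mul_eq_zero.1 h3).resolve_left h4
  rw [h2, hu (f 1) (f 0), h5]

lemma injective_path_edge {n k : ℕ} {f : Fin (k + 1) → Fin (n + 1)} (hf : Function.Injective f) :
    Function.Injective fun i : Fin k => s(f i.castSucc, f i.succ) := by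
  intro i j h
  simp only [Sym2.eq_iff, hf.eq_iff, Fin.ext_iff, Fin.val_castSucc, Fin.val_succ] at h
  exact Fin.ext (by omega)

lemma dotProduct_uIncVec {n : ℕ} (a : Sym2 (Fin (n + 1)) → ℝ)
    (P : Finset (Sym2 (Fin (n + 1)))) : a ⬝ᵥ uIncVec P = ∑ e ∈ P, a e := by
  simp [dotProduct, uIncVec]

lemma sum_image_path_edge {n k : ℕ} (a : Sym2 (Fin (n + 1)) → ℝ)
    {f : Fin (k + 1) → Fin (n + 1)} (hf : Function.Injective f) :
    ∑ e ∈ univ.image (fun i : Fin k => s(f i.castSucc, f i.succ)), a e =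
      ∑ i : Fin k, a s(f i.castSucc, f i.succ) :=
  sum_image (injective_path_edge hf).injOn

lemma isConstOnPaths_of_isUPath {n : ℕ} (a : Sym2 (Fin (n + 1)) → ℝ) (b : ℝ) (r : ℕ)
    (hn : 0 < n)
    (h : ∀ P, IsUPath n P → P.card = r + 2 → ∑ e ∈ P, a e = b) :
    IsConstOnPaths (V := {x : Fin (n + 1) // x ≠ 0 ∧ x ≠ Fin.last n})
      (fun x => a s(0, x.1)) (fun x => a s(x.1, Fin.last n)) (fun x y => a s(x.1, y.1)) b r := by
  intro f hf
  let g : ℕ → Fin (n + 1) := fun i =>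
    if i = 0 then 0 else if i = r + 2 then Fin.last n else (f (i - 1)).1
  have hlast : (0 : Fin (n + 1)) ≠ Fin.last n := by
    simp [Fin.ext_iff]; omega
  have hg : Function.Injective fun i : Fin (r + 2 + 1) => g i := by
    intro i j hij
    have hi := i.2
    have hj := j.2
    apply Fin.ext
    have hfi := (f (i - 1)).2
    have hfj := (f (j - 1)).2
    simp only [g] at hij
    split_ifs at hij with h1 h2 h3 h4 h5 h6 h7 h8
    all_goals first
      | omega
      | exact absurd hij hlast
      | exact absurd hij.symm hlast
      | exact absurd hij hfi.1
      | exact absurd hij hfi.2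
      | exact absurd hij.symm hfj.1
      | exact absurd hij.symm hfj.2
      | skip
    have := hf (Set.mem_Iio.2 (by omega)) (Set.mem_Iio.2 (by omega)) (Subtype.ext hij)
    omega
  have hP := h (univ.image fun i : Fin (r + 2) => s(g i.castSucc, g i.succ))
    ⟨r + 2, fun i => g i, hg, by simp [g], by simp [g], rfl⟩
    (by
      rw [card_image_of_injective _ (injective_path_edge hg)]
      simp)
  have h1 := sum_image_path_edge a hg
  rw [h1] at hP
  simp only [Fin.val_castSucc, Fin.val_succ] at hP
  rw [Fin.sum_univ_eq_sum_range (fun i => a s(g i, g (i + 1))), sum_range_succ,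
    sum_range_succ'] at hP
  have h2 : ∑ i ∈ range r, a s(g (i + 1), g (i + 1 + 1)) =
      ∑ i ∈ range r, a s((f i).1, (f (i + 1)).1) := by
    refine sum_congr rfl fun i hi => ?_
    rw [mem_range] at hi
    simp [g, show i ≠ r + 1 by omega, show i ≠ r by omega]
  rw [h2] at hP
  simp [g] at hP
  linarith

/-- The linear equations valid for all `(0,n)`-paths with at least two edges: the coordinates of
loops and of the edge `{0,n}` vanish, and the degrees of `0` and `n` are constant. -/
noncomputable def pathEquations (n : ℕ) :
    ((Fin (n + 1) → ℝ) × ℝ × ℝ × ℝ) →ₗ[ℝ] (Sym2 (Fin (n + 1)) → ℝ) where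
  toFun p e := (∑ i, if e = s(i, i) then p.1 i else 0) +
    (if e = s(0, Fin.last n) then p.2.1 else 0) +
    (if 0 ∈ e then p.2.2.1 else 0) + (if Fin.last n ∈ e then p.2.2.2 else 0)
  map_add' p q := by
    ext e
    simp only [Prod.fst_add, Prod.snd_add, Pi.add_apply]
    have : (∑ i, if e = s(i, i) then p.1 i + q.1 i else 0) =
        (∑ i, if e = s(i, i) then p.1 i else 0) + ∑ i, if e = s(i, i) then q.1 i else 0 := by
      rw [← sum_add_distrib]
      exact sum_congr rfl fun i _ => by split_ifs <;> simp
    rw [this]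
    split_ifs <;> ring
  map_smul' c p := by
    ext e
    simp only [Prod.smul_fst, Prod.smul_snd, Pi.smul_apply, smul_eq_mul, RingHom.id_apply,
      mul_add, mul_sum, mul_ite, mul_zero]

lemma pathEquations_loop {n : ℕ} (p : (Fin (n + 1) → ℝ) × ℝ × ℝ × ℝ) (hn : 0 < n)
    (x : Fin (n + 1)) :
    pathEquations n p s(x, x) = p.1 x + (if x = 0 then p.2.2.1 else 0) +
      (if x = Fin.last n then p.2.2.2 else 0) := by
  have hlast : (0 : Fin (n + 1)) ≠ Fin.last n := by
    simp [Fin.ext_iff]; omega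
  have h : ¬ (x = 0 ∧ x = Fin.last n) := fun h => hlast (h.1.symm.trans h.2)
  have h' : ¬ (x = Fin.last n ∧ x = 0) := fun h => hlast (h.2.symm.trans h.1)
  simp [pathEquations, h, h', eq_comm]

lemma pathEquations_of_ne {n : ℕ} (p : (Fin (n + 1) → ℝ) × ℝ × ℝ × ℝ)
    {x y : Fin (n + 1)} (hxy : x ≠ y) :
    pathEquations n p s(x, y) = (if s(x, y) = s(0, Fin.last n) then p.2.1 else 0) +
      (if 0 = x ∨ 0 = y then p.2.2.1 else 0) +
      (if Fin.last n = x ∨ Fin.last n = y then p.2.2.2 else 0) := by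
  have h : ∀ i, s(x, y) ≠ s(i, i) := by
    intro i hi
    rw [Sym2.eq_iff] at hi
    exact hxy (by rcases hi with h | h <;> rw [h.1, h.2])
  simp only [pathEquations, LinearMap.coe_mk, AddHom.coe_mk, h, if_false, sum_const_zero,
    zero_add, Sym2.mem_iff]

lemma pathEquations_injective {n : ℕ} (hn : 2 ≤ n) : Function.Injective (pathEquations n) := by
  rw [← LinearMap.ker_eq_bot, LinearMap.ker_eq_bot']
  rintro ⟨d, γ, α, β⟩ hp
  have h0l : (0 : Fin (n + 1)) ≠ Fin.last n := by
    simp [Fin.ext_iff]; omega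
  let z : Fin (n + 1) := ⟨1, by omega⟩
  have h0z : (0 : Fin (n + 1)) ≠ z := by simp [z, Fin.ext_iff]
  have hzl : z ≠ Fin.last n := by
    simp [z, Fin.ext_iff]; omega
  have h1 := congrFun hp s(0, z)
  have h2 := congrFun hp s(z, Fin.last n)
  have h3 := congrFun hp s(0, Fin.last n)
  rw [pathEquations_of_ne _ h0z] at h1
  rw [pathEquations_of_ne _ hzl] at h2
  rw [pathEquations_of_ne _ h0l] at h3
  have hα : α = 0 := by
    simpa [hzl, h0z, h0l, h0l.symm, hzl.symm] using h1
  have hβ : β = 0 := by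
    simpa [hzl, h0z, h0l, h0l.symm, hzl.symm, h0z.symm] using h2
  have hγ : γ = 0 := by simpa [hα, hβ] using h3
  have hd : d = 0 := by
    ext x
    have h := congrFun hp s(x, x)
    rw [pathEquations_loop _ (by omega)] at h
    simpa [hα, hβ] using h
  rw [hd, hγ, hα, hβ]
  rfl

lemma sum_pathEquations_of_isUPath {n : ℕ} (p : (Fin (n + 1) → ℝ) × ℝ × ℝ × ℝ)
    {P : Finset (Sym2 (Fin (n + 1)))} (hP : IsUPath n P) (hcard : 2 ≤ P.card) :
    ∑ e ∈ P, pathEquations n p e = p.2.2.1 + p.2.2.2 := by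
  obtain ⟨k, f, hf, h0, hl, rfl⟩ := hP
  rw [card_image_of_injective _ (injective_path_edge hf), card_univ, Fintype.card_fin] at hcard
  obtain ⟨k, rfl⟩ : ∃ j, k = j + 1 := ⟨k - 1, by omega⟩
  rw [sum_image_path_edge _ hf]
  have h : ∀ i : Fin (k + 1), pathEquations n p s(f i.castSucc, f i.succ) =
      (if i = 0 then p.2.2.1 else 0) + (if i = Fin.last k then p.2.2.2 else 0) := by
    intro i
    rw [pathEquations_of_ne _ (hf.ne (by simp [Fin.ext_iff]))]
    rw [← h0, ← hl]
    simp only [Sym2.eq_iff, hf.eq_iff, Fin.ext_iff, Fin.val_castSucc, Fin.val_succ, Fin.val_last,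
      Fin.val_zero]
    have hi := i.2
    rw [if_neg (by omega), zero_add]
    congr 1
    · exact if_congr (by omega) rfl rfl
    · exact if_congr (by omega) rfl rfl
  simp [h, sum_add_distrib]

lemma mem_range_pathEquations {n : ℕ} (hn : 2 ≤ n) {a : Sym2 (Fin (n + 1)) → ℝ} {b : ℝ}
    {k r : ℕ} (hkr : k < r) (hr2 : 2 ≤ r) (hrn : r + 2 ≤ n)
    (hk : ∀ P, IsUPath n P → P.card = k + 2 → ∑ e ∈ P, a e = b)
    (hr : ∀ P, IsUPath n P → P.card = r + 2 → ∑ e ∈ P, a e = b) :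
    a ∈ LinearMap.range (pathEquations n) := by
  have h0l : (0 : Fin (n + 1)) ≠ Fin.last n := by
    simp [Fin.ext_iff]; omega
  have hV : r + 1 ≤ Fintype.card {x : Fin (n + 1) // x ≠ 0 ∧ x ≠ Fin.last n} := by
    have h1 : (univ.filter fun x : Fin (n + 1) => x ≠ 0 ∧ x ≠ Fin.last n) =
        univ \ {0, Fin.last n} := by
      ext x; simp
    rw [Fintype.card_subtype, h1, card_sdiff_of_subset (subset_univ _), card_pair h0l]
    simp
    omega
  obtain ⟨hu, hv, hw⟩ := (isConstOnPaths_of_isUPath a b k (by omega) hk).trivial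
    (fun x y => by rw [Sym2.eq_swap]) (isConstOnPaths_of_isUPath a b r (by omega) hr) hkr hr2 hV
  let z : {x : Fin (n + 1) // x ≠ 0 ∧ x ≠ Fin.last n} :=
    ⟨⟨1, by omega⟩, by simp [Fin.ext_iff], by simp [Fin.ext_iff]; omega⟩
  let α := a s(0, z.1)
  let β := a s(z.1, Fin.last n)
  refine ⟨⟨fun x => a s(x, x) - (if x = 0 then α else 0) - (if x = Fin.last n then β else 0),
    a s(0, Fin.last n) - α - β, α, β⟩, ?_⟩
  have key : ∀ x y : Fin (n + 1), x < y → pathEquations n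
      ⟨fun x => a s(x, x) - (if x = 0 then α else 0) - (if x = Fin.last n then β else 0),
      a s(0, Fin.last n) - α - β, α, β⟩ s(x, y) = a s(x, y) := by
    intro x y hxy
    rw [pathEquations_of_ne _ hxy.ne]
    have hy0 : y ≠ 0 := (Fin.pos_of_ne_zero (fun h => by simp [h] at hxy)).ne'
    have hxl : x ≠ Fin.last n := (hxy.trans_le (Fin.le_last y)).ne
    by_cases hx0 : x = 0 <;> by_cases hyl : y = Fin.last n
    · subst hx0 hyl
      simp
      ring
    · subst hx0
      have := hu ⟨y, hy0, hyl⟩ z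
      simp [hyl, Ne.symm hyl, hxl.symm, h0l, α, this]
    · subst hyl
      have := hv ⟨x, hx0, hxl⟩ z
      simp [hx0, Ne.symm hx0, hxl, h0l, β, this]
    · have := hw ⟨x, hx0, hxl⟩ ⟨y, hy0, hyl⟩ (by simpa using hxy.ne)
      simp [hx0, Ne.symm hx0, hxl, Ne.symm hyl, hxl.symm, hy0.symm, this]
  ext e
  induction e with
  | _ x y =>
    rcases lt_trichotomy x y with h | rfl | h
    · exact key x y h
    · rw [pathEquations_loop _ (by omega)]
      ring
    · rw [Sym2.eq_swap (a := x)]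
      exact key y x h

/-- The functionals vanishing on the directions of the affine hull of `s`. -/
lemma mem_dualAnnihilator_vectorSpan_iff {W : Type*} [AddCommGroup W] [Module ℝ W] {s : Set W}
    {φ : Module.Dual ℝ W} :
    φ ∈ (vectorSpan ℝ s).dualAnnihilator ↔ ∃ b, ∀ x ∈ s, φ x = b := by
  rw [Submodule.mem_dualAnnihilator]
  constructor
  · intro h
    rcases s.eq_empty_or_nonempty with rfl | ⟨y, hy⟩
    · exact ⟨0, by simp⟩
    · refine ⟨φ y, fun x hx => ?_⟩
      have := h _ (vsub_mem_vectorSpan ℝ hx hy)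
      rwa [vsub_eq_sub, map_sub, sub_eq_zero] at this
  · rintro ⟨b, hb⟩
    have : vectorSpan ℝ s ≤ LinearMap.ker φ := by
      rw [vectorSpan, Submodule.span_le]
      rintro _ ⟨x, hx, y, hy, rfl⟩
      simp [hb x hx, hb y hy]
    exact fun x hx => this hx

lemma exists_lt_four_le {m : ℕ} (hm : 2 ≤ m) {c : Fin m → ℕ} (hmono : StrictMono c)
    (hc2 : ∀ p, 2 ≤ c p) (hCS : Set.range c ≠ {2, 3}) : ∃ p q, c p < c q ∧ 4 ≤ c q := by
  let p : Fin m := ⟨0, by omega⟩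
  let q : Fin m := ⟨m - 1, by omega⟩
  have hpq : c p < c q := hmono (Fin.mk_lt_mk.2 (by omega))
  refine ⟨p, q, hpq, ?_⟩
  by_contra! hq
  have hp2 := hc2 p
  refine hCS (Set.Subset.antisymm ?_ ?_)
  · rintro _ ⟨i, rfl⟩
    have hi : c i ≤ c q := hmono.monotone (Fin.mk_le_mk.2 (by omega))
    have := hc2 i
    simp only [Set.mem_insert_iff, Set.mem_singleton_iff]
    omega
  · rintro x (rfl | rfl)
    · exact ⟨p, by omega⟩
    · exact ⟨q, by omega⟩

/-- **Dimension of the undirected cardinality constrained path polytope.**  For `n ≥ 4`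
and a cardinality sequence `c` in `CS` (`m ≥ 2`, `2 ≤ c 0 < ⋯ < c (m-1) ≤ n`,
`c ≠ (2,3)`), the polytope `P_{0,n-path}^c(K_{n+1})` has dimension
`|E| − 3 = n(n+1)/2 − 3`. -/
theorem dim_uPathPolytope (n m : ℕ) (hn : 4 ≤ n) (hm : 2 ≤ m)
    (c : Fin m → ℕ) (hmono : StrictMono c)
    (hc2 : ∀ p, 2 ≤ c p) (hcn : ∀ p, c p ≤ n)
    (hCS : Set.range c ≠ {2, 3}) :
    adim (uPathPolytope n c) = n * (n + 1) / 2 - 3 := by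
  obtain ⟨p, q, hpq, hq⟩ := exists_lt_four_le hm hmono hc2 hCS
  have hp2 := hc2 p
  have hqn := hcn q
  unfold adim uPathPolytope
  rw [← direction_affineSpan, affineSpan_convexHull, direction_affineSpan]
  set s : Set (Sym2 (Fin (n + 1)) → ℝ) :=
    {x | ∃ P, IsUPath n P ∧ (∃ p, P.card = c p) ∧ x = uIncVec P}
  have hann : (vectorSpan ℝ s).dualAnnihilator = LinearMap.range
      ((dotProductEquiv ℝ (Sym2 (Fin (n + 1)))).toLinearMap ∘ₗ pathEquations n) := by
    ext φ
    obtain ⟨a, rfl⟩ := (dotProductEquiv ℝ (Sym2 (Fin (n + 1)))).surjective φ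
    rw [mem_dualAnnihilator_vectorSpan_iff, LinearMap.range_comp]
    constructor
    · rintro ⟨b, hb⟩
      have hconst : ∀ P, IsUPath n P → ∀ i, P.card = c i → ∑ e ∈ P, a e = b := by
        intro P hP i hi
        rw [← dotProduct_uIncVec]
        exact hb _ ⟨P, hP, ⟨i, hi⟩, rfl⟩
      exact Submodule.mem_map_of_mem (mem_range_pathEquations (k := c p - 2) (r := c q - 2)
        (b := b) (by omega) (by omega) (by omega) (by omega)
        (fun P hP h => hconst P hP p (by omega)) (fun P hP h => hconst P hP q (by omega)))
    · rintro ⟨_, ⟨x, rfl⟩, hx⟩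
      obtain rfl := (dotProductEquiv ℝ (Sym2 (Fin (n + 1)))).injective hx
      refine ⟨x.2.2.1 + x.2.2.2, ?_⟩
      rintro _ ⟨P, hP, ⟨i, hi⟩, rfl⟩
      change pathEquations n x ⬝ᵥ uIncVec P = _
      rw [dotProduct_uIncVec, sum_pathEquations_of_isUPath x hP (hi ▸ hc2 i)]
  have hinj : Function.Injective
      ((dotProductEquiv ℝ (Sym2 (Fin (n + 1)))).toLinearMap ∘ₗ pathEquations n) :=
    (dotProductEquiv ℝ (Sym2 (Fin (n + 1)))).injective.comp (pathEquations_injective (by omega))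
  have hdim := Subspace.finrank_add_finrank_dualAnnihilator_eq (vectorSpan ℝ s)
  rw [hann, LinearMap.finrank_range_of_inj hinj] at hdim
  simp only [Module.finrank_prod, Module.finrank_fintype_fun_eq_card, Fintype.card_fin,
    Module.finrank_self, Sym2.card, Nat.choose_two_right, Nat.add_sub_cancel] at hdim
  have h : (n + 1 + 1) * (n + 1) / 2 = n * (n + 1) / 2 + (n + 1) := by
    rw [show (n + 1 + 1) * (n + 1) = n * (n + 1) + (n + 1) * 2 by ring,
      Nat.add_mul_div_right _ _ two_pos]
  omega
end
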